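/- For every discount factor α ∈ (0,1), every n ≥ 0, every b ∈ {0,1}, every positive integer v1 and every non-negative integer x, the value-iteration functions satisfy V_{α,n}((v1, ∞, b)) ≤ V_{α,n}((v1+x, ∞, b)). (n-step form of Lemma 3, second part.) -/

import Mathlib

/-!
Re-transmission MDP: states `(v1, v2, b)` with `v1 : ℕ` (age at the user, `≥ 1`),
`v2 : Option ℕ` (age of the packet at the BS; `none` means empty queue, i.e. `∞`),
`b : Bool` (fresh packet available).  Value iteration `Viter p q1 q2 α n v1 v2 b`
implements `V_{α,n}` as in the paper.
-/

noncomputable section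

/-- Q-value of action `0` (re-transmit the old packet of age `k`) with continuation `W`. -/
def Qact0 (p q2 α : ℝ) (W : ℕ → Option ℕ → Bool → ℝ) (v1 k : ℕ) : ℝ :=
  q2 * ((k : ℝ) + 1) + (1 - q2) * ((v1 : ℝ) + 1)
    + α * (p * (1 - q2) * W (v1 + 1) (some (k + 1)) true
      + (1 - p) * (1 - q2) * W (v1 + 1) (some (k + 1)) false
      + (1 - p) * q2 * W (k + 1) none false
      + p * q2 * W (k + 1) none true)

/-- Q-value of action `1` (transmit the fresh packet) with continuation `W`. -/
def Qact1 (p q1 α : ℝ) (W : ℕ → Option ℕ → Bool → ℝ) (v1 : ℕ) : ℝ :=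
  q1 * 1 + (1 - q1) * ((v1 : ℝ) + 1)
    + α * (p * (1 - q1) * W (v1 + 1) (some 1) true
      + (1 - p) * (1 - q1) * W (v1 + 1) (some 1) false
      + (1 - p) * q1 * W 1 none false
      + p * q1 * W 1 none true)

/-- Q-value of action `2` (idle, empty queue) with continuation `W`. -/
def Qact2 (p α : ℝ) (W : ℕ → Option ℕ → Bool → ℝ) (v1 : ℕ) : ℝ :=
  ((v1 : ℝ) + 1)
    + α * ((1 - p) * W (v1 + 1) none false + p * W (v1 + 1) none true)

/-- Value iteration `V_{α,n}` for the re-transmission MDP: `V_{α,0} = 0` and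
`V_{α,n}(s) = min` over feasible actions of the corresponding Q-value. -/
def Viter (p q1 q2 α : ℝ) : ℕ → ℕ → Option ℕ → Bool → ℝ
  | 0 => fun _ _ _ => 0
  | n + 1 => fun v1 v2 b =>
      match v2, b with
      | none, false => Qact2 p α (Viter p q1 q2 α n) v1
      | none, true => Qact1 p q1 α (Viter p q1 q2 α n) v1
      | some k, false => Qact0 p q2 α (Viter p q1 q2 α n) v1 k
      | some k, true =>
          min (Qact0 p q2 α (Viter p q1 q2 α n) v1 k)
            (Qact1 p q1 α (Viter p q1 q2 α n) v1)

end


/-- Value iteration is monotone in `v1`, the other components being fixed. -/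
theorem viter_mono_aux (p q1 q2 α : ℝ)
    (hp0 : 0 < p) (hp1 : p ≤ 1) (hq10 : 0 < q1) (hq12 : q1 < q2) (hq21 : q2 < 1)
    (hα0 : 0 < α) (n : ℕ) : ∀ (v w : ℕ) (_ : v ≤ w) (o : Option ℕ) (b : Bool),
    Viter p q1 q2 α n v o b ≤ Viter p q1 q2 α n w o b := by
  have a1 : 0 ≤ 1 - p := by linarith
  have a2 : 0 ≤ 1 - q1 := by linarith
  have a3 : 0 ≤ 1 - q2 := by linarith
  induction n with
  | zero => intro v w _ o b; simp [Viter]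
  | succ n ih =>
    intro v w h o b
    have h1 : v + 1 ≤ w + 1 := by omega
    have hc : (v : ℝ) ≤ w := by exact_mod_cast h
    have e0 : ∀ k, Qact0 p q2 α (Viter p q1 q2 α n) v k
        ≤ Qact0 p q2 α (Viter p q1 q2 α n) w k := by
      intro k
      have i1 := ih _ _ h1 (some (k + 1)) true
      have i2 := ih _ _ h1 (some (k + 1)) false
      unfold Qact0
      gcongr
    have e1 : Qact1 p q1 α (Viter p q1 q2 α n) v
        ≤ Qact1 p q1 α (Viter p q1 q2 α n) w := by
      have i1 := ih _ _ h1 (some 1) true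
      have i2 := ih _ _ h1 (some 1) false
      unfold Qact1
      gcongr
    have e2 : Qact2 p α (Viter p q1 q2 α n) v
        ≤ Qact2 p α (Viter p q1 q2 α n) w := by
      have i1 := ih _ _ h1 none true
      have i2 := ih _ _ h1 none false
      unfold Qact2
      gcongr
    rcases o with _ | k <;> cases b
    · exact e2
    · exact e1
    · exact e0 k
    · exact min_le_min (e0 k) e1

/-- n-step form of Lemma 3, second part: monotonicity of the value-iteration
functions in `v1` for states with an empty queue (`v2 = ∞`). -/
theorem viter_monotone_in_state_empty_queue (p q1 q2 α : ℝ)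
    (hp0 : 0 < p) (hp1 : p ≤ 1) (hq10 : 0 < q1) (hq12 : q1 < q2) (hq21 : q2 < 1)
    (hα0 : 0 < α) (hα1 : α < 1)
    (n : ℕ) (b : Bool) (v1 x : ℕ) (hv1 : 1 ≤ v1) :
    Viter p q1 q2 α n v1 none b ≤ Viter p q1 q2 α n (v1 + x) none b := by
  exact viter_mono_aux p q1 q2 α hp0 hp1 hq10 hq12 hq21 hα0 n _ _ (Nat.le_add_right _ _) _ _
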